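/- arXiv:2202.06134 — 6 statements merged into one kernel-verified Lean document; each statement's English description precedes it below -/
import Mathlib

section
/- Let X = A·∂/∂x + B·∂/∂y (A, B ∈ ℂ[x,y] coprime, not both zero) be an algebraically integrable planar polynomial vector field with X ≠ c·∂/∂y for every c ∈ ℂ\{0}, let f = f1/f2 be a primitive rational first integral of X, let g = α·f1 + β·f2 ∈ ℂ(α,β)[x,y] be the generic algebraic invariant curve, and for each δ ∈ ℕ let G_δ ∈ ℂ(α,β)[X0,X1,Y0,Y1] be the δ-bihomogenization of g. Then there exists δ1 ∈ ℕ such that: (i) for every integer δ > δ1 and every (y0,y1) ∈ ℂ²\{(0,0)}, if G_δ(0,1,y0,y1) = 0 then y0 = 0; (ii) for every nonnegative integer δ < δ1, G_δ(0,1,1,0) = 0; and (iii) G_{δ1}(0,1,1,0) ≠ 0. -/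
open MvPolynomial

noncomputable section

/-- Bivariate polynomials over `ℂ`: the ring `ℂ[x,y]`, with variable `0 = x`, `1 = y`. -/
abbrev P2 : Type := MvPolynomial (Fin 2) ℂ

/-- The field of rational functions `ℂ(x,y)`. -/
abbrev RF2 : Type := FractionRing P2

/-- The rational function `p/q ∈ ℂ(x,y)`. -/
def rf (p q : P2) : RF2 := algebraMap P2 RF2 p / algebraMap P2 RF2 q

/-- `f ∈ ℂ(x,y)` is a constant. -/
def IsConstRF (f : RF2) : Prop := ∃ c : ℂ, f = algebraMap P2 RF2 (C c)

/-- Quotient-rule form of the first-integral condition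
`A·∂(p/q)/∂x + B·∂(p/q)/∂y = 0` for the rational function `p/q`. -/
def FirstIntegralRep (A B p q : P2) : Prop :=
  A * (q * pderiv 0 p - p * pderiv 0 q) + B * (q * pderiv 1 p - p * pderiv 1 q) = 0

/-- `f ∈ ℂ(x,y)` is composite: `f = u ∘ h` with `u ∈ ℂ(t)` of degree `≥ 2`
and `h ∈ ℂ(x,y)` nonconstant. -/
def IsCompositeRF (f : RF2) : Prop :=
  ∃ (u : RatFunc ℂ) (h : RF2), ¬ IsConstRF h ∧
    2 ≤ max u.num.natDegree u.denom.natDegree ∧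
    f = RatFunc.eval ((algebraMap P2 RF2).comp (C : ℂ →+* P2)) h u

/-- `f1/f2` is a primitive (reduced and noncomposite) rational first integral of
the planar vector field `X = A ∂/∂x + B ∂/∂y`. -/
def IsPrimitiveFI (A B f1 f2 : P2) : Prop :=
  f2 ≠ 0 ∧ IsRelPrime f1 f2 ∧ ¬ IsConstRF (rf f1 f2) ∧
    FirstIntegralRep A B f1 f2 ∧ ¬ IsCompositeRF (rf f1 f2)

variable {K : Type*} [Field K]

/-- With respect to the bigrading of `K[X0,X1,Y0,Y1]` in which `X0, X1` have
bidegree `(1,0)`, `Y0` has bidegree `(0,1)` and `Y1` has bidegree `(−δ,1)`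
(variables `0 = X0`, `1 = X1`, `2 = Y0`, `3 = Y1`), the polynomial `G` is
bigraded homogeneous of bidegree `(d1, d2)`. -/
def IsBihomogeneous (δ : ℕ) (d1 d2 : ℤ) (G : MvPolynomial (Fin 4) K) : Prop :=
  ∀ m ∈ G.support, ((m 0 : ℤ) + (m 1 : ℤ) - (δ : ℤ) * (m 3 : ℤ) = d1) ∧
    ((m 2 : ℤ) + (m 3 : ℤ) = d2)

/-- The exponent vector of the monomial of the `δ`-bihomogenization corresponding
to a monomial `x^i y^j` of `g` (where `i = m 0`, `j = m 1`), namely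
`X0^(a−i+δj) · X1^i · Y0^(b−j) · Y1^j`, where `a = max {i' − δj'}` over the
support of `g` and `b = deg_y g`.  (The `X0`-exponent `a − i + δj` is computed
in `ℕ` as `(max_{m'} (i' + δj − δj')) − i`, which agrees with the integer value
since the maximum is attained at a nonnegative value `≥ i`.) -/
def bihomExp (δ : ℕ) (g : MvPolynomial (Fin 2) K) (m : Fin 2 →₀ ℕ) : Fin 4 →₀ ℕ :=
  Finsupp.single 0 ((g.support.sup fun m' => m' 0 + δ * m 1 - δ * m' 1) - m 0) +
    Finsupp.single 1 (m 0) +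
    Finsupp.single 2 ((g.support.sup fun m' => m' 1) - m 1) +
    Finsupp.single 3 (m 1)

/-- The `δ`-bihomogenization `G_δ = Σ g_{ij} X0^(a−i+δj) X1^i Y0^(b−j) Y1^j`
of a polynomial `g = Σ g_{ij} x^i y^j ∈ K[x,y]`. -/
def bihom (δ : ℕ) (g : MvPolynomial (Fin 2) K) : MvPolynomial (Fin 4) K :=
  ∑ m ∈ g.support, monomial (bihomExp δ g m) (coeff m g)

/-- The coefficient field `ℂ(α,β)` (the fraction field of `ℂ[α,β]`,
with `α` the variable `0` and `β` the variable `1`). -/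
abbrev Kab : Type := FractionRing (MvPolynomial (Fin 2) ℂ)

/-- The inclusion `ℂ → ℂ(α,β)`. -/
def liftC : ℂ →+* Kab :=
  (algebraMap (MvPolynomial (Fin 2) ℂ) Kab).comp (C : ℂ →+* MvPolynomial (Fin 2) ℂ)

/-- The generic algebraic invariant curve `g = α·f1 + β·f2 ∈ ℂ(α,β)[x,y]`
associated to the primitive rational first integral `f1/f2`. -/
def genericCurve (f1 f2 : P2) : MvPolynomial (Fin 2) Kab :=
  C (algebraMap (MvPolynomial (Fin 2) ℂ) Kab (X 0)) * MvPolynomial.map liftC f1 +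
    C (algebraMap (MvPolynomial (Fin 2) ℂ) Kab (X 1)) * MvPolynomial.map liftC f2

/-- The exponent of `X0` vanishes exactly at the monomials maximizing `i - δ j`. -/
lemma bihomExp_zero_eq_zero_iff {K : Type*} [Field K] (δ : ℕ) (g : MvPolynomial (Fin 2) K)
    (m : Fin 2 →₀ ℕ) :
    bihomExp δ g m 0 = 0 ↔ ∀ m' ∈ g.support, m' 0 + δ * m 1 ≤ m 0 + δ * m' 1 := by
  simp [bihomExp, tsub_eq_zero_iff_le, Finset.sup_le_iff]

lemma eval_bihom {K : Type*} [Field K] (δ : ℕ) (g : MvPolynomial (Fin 2) K) (y0 y1 : K) :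
    MvPolynomial.eval ![(0 : K), 1, y0, y1] (bihom δ g) =
      ∑ m ∈ g.support, coeff m g *
        (0 ^ bihomExp δ g m 0 * y0 ^ bihomExp δ g m 2 * y1 ^ m 1) := by
  rw [bihom, map_sum]
  refine Finset.sum_congr rfl fun m _ => ?_
  have h3 : bihomExp δ g m 3 = m 1 := by simp [bihomExp]
  rw [eval_monomial, Finsupp.prod_fintype _ _ (by simp), Fin.prod_univ_four, h3]
  simp

/-- A polynomial not divisible by `y` has a threshold `δ1` as in the main theorem. -/
lemma exists_delta1_of_exists_mem_support {K : Type*} [Field K] (g : MvPolynomial (Fin 2) K)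
    (hg : ∃ m ∈ g.support, m 1 = 0) :
    ∃ δ1 : ℕ,
      (∀ δ : ℕ, δ1 < δ → ∀ y0 y1 : K,
        MvPolynomial.eval ![(0 : K), 1, y0, y1] (bihom δ g) = 0 → y0 = 0) ∧
      (∀ δ : ℕ, δ < δ1 → MvPolynomial.eval ![(0 : K), 1, 1, 0] (bihom δ g) = 0) ∧
      MvPolynomial.eval ![(0 : K), 1, 1, 0] (bihom δ1 g) ≠ 0 := by
  classical
  obtain ⟨m₀, hm₀, hmax⟩ := (g.support.filter fun m => m 1 = 0).exists_max_image
    (fun m => m 0) (by simpa [Finset.Nonempty] using hg)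
  obtain ⟨hs, h0⟩ := Finset.mem_filter.1 hm₀
  replace hmax : ∀ m ∈ g.support, m 1 = 0 → m 0 ≤ m₀ 0 :=
    fun m hm h => hmax m (Finset.mem_filter.2 ⟨hm, h⟩)
  have hex : ∃ δ : ℕ, ∀ m ∈ g.support, m 0 ≤ m₀ 0 + δ * m 1 := by
    refine ⟨g.support.sup fun m => m 0, fun m hm => ?_⟩
    rcases Nat.eq_zero_or_pos (m 1) with h | h
    · exact (hmax m hm h).trans (Nat.le_add_right _ _)
    · exact (Finset.le_sup (f := fun m : Fin 2 →₀ ℕ => m 0) hm).trans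
        ((Nat.le_mul_of_pos_right _ h).trans (Nat.le_add_left _ _))
  have hlt : ∀ m ∈ g.support, m ≠ m₀ → m 1 = 0 → m 0 < m₀ 0 := by
    refine fun m hm hne h => lt_of_le_of_ne (hmax m hm h) fun h' => hne ?_
    ext i
    fin_cases i
    · exact h'
    · exact h.trans h0.symm
  have hexp₀ : ∀ δ, (∀ m ∈ g.support, m 0 ≤ m₀ 0 + δ * m 1) → bihomExp δ g m₀ 0 = 0 := by
    intro δ hδ
    rw [bihomExp_zero_eq_zero_iff]
    simpa [h0] using hδ
  have hexp : ∀ δ, ∀ m ∈ g.support, m ≠ m₀ → m 1 = 0 → bihomExp δ g m 0 ≠ 0 := by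
    intro δ m hm hne h hz
    have := (bihomExp_zero_eq_zero_iff δ g m).1 hz m₀ hs
    have := hlt m hm hne h
    simp only [h, h0] at *
    omega
  refine ⟨Nat.find hex, fun δ hδ y0 y1 h => ?_, fun δ hδ => ?_, ?_⟩
  · have hle := Nat.find_spec hex
    rw [eval_bihom, Finset.sum_eq_single_of_mem m₀ hs] at h
    · rw [hexp₀ δ fun m hm => (hle m hm).trans (by gcongr), h0] at h
      simp only [pow_zero, one_mul, mul_one] at h
      exact eq_zero_of_pow_eq_zero ((mul_eq_zero.1 h).resolve_left (mem_support_iff.1 hs))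
    · intro m hm hne
      have hz : bihomExp δ g m 0 ≠ 0 := by
        rcases Nat.eq_zero_or_pos (m 1) with h1 | h1
        · exact hexp δ m hm hne h1
        · intro hz
          have h2 := (bihomExp_zero_eq_zero_iff δ g m).1 hz m₀ hs
          have h3 := hle m hm
          have h4 := Nat.mul_lt_mul_of_pos_right hδ h1
          simp only [h0, mul_zero] at h2
          omega
      simp [zero_pow hz]
  · rw [eval_bihom]
    refine Finset.sum_eq_zero fun m hm => ?_
    by_cases h1 : m 1 = 0
    · have hz : bihomExp δ g m 0 ≠ 0 := by
        intro hz
        refine Nat.find_min hex hδ fun m' hm' => ?_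
        have h2 := (bihomExp_zero_eq_zero_iff δ g m).1 hz m' hm'
        have h3 := hmax m hm h1
        simp only [h1, mul_zero] at h2
        omega
      simp [zero_pow hz]
    · simp [zero_pow h1]
  · rw [eval_bihom, Finset.sum_eq_single_of_mem m₀ hs]
    · rw [hexp₀ _ (Nat.find_spec hex), h0]
      simpa using hs
    · intro m hm hne
      by_cases h1 : m 1 = 0
      · simp [zero_pow (hexp _ m hm hne h1)]
      · simp [zero_pow h1]

lemma coeff_genericCurve (f1 f2 : P2) (m : Fin 2 →₀ ℕ) :
    coeff m (genericCurve f1 f2) =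
      algebraMap (MvPolynomial (Fin 2) ℂ) Kab
        (X 0 * C (coeff m f1) + X 1 * C (coeff m f2)) := by
  simp [genericCurve, coeff_map, liftC]

/-- The parameters `α` and `β` are linearly independent over `ℂ`. -/
lemma coeff_genericCurve_eq_zero_iff (f1 f2 : P2) (m : Fin 2 →₀ ℕ) :
    coeff m (genericCurve f1 f2) = 0 ↔ coeff m f1 = 0 ∧ coeff m f2 = 0 := by
  rw [coeff_genericCurve, map_eq_zero_iff _ (IsFractionRing.injective _ _)]
  refine ⟨fun h => ⟨?_, ?_⟩, fun h => by simp [h.1, h.2]⟩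
  · simpa using congrArg (MvPolynomial.eval ![(1 : ℂ), 0]) h
  · simpa using congrArg (MvPolynomial.eval ![(0 : ℂ), 1]) h

lemma X_one_dvd_of_coeff_eq_zero {p : P2} (h : ∀ m : Fin 2 →₀ ℕ, m 1 = 0 → coeff m p = 0) :
    (X 1 : P2) ∣ p := by
  rw [X_dvd_iff_modMonomial_eq_zero]
  ext m
  by_cases hm : m 1 = 0
  · rw [coeff_modMonomial_of_not_le _ (by simp [Finsupp.single_le_iff, hm]), h m hm, coeff_zero]
  · rw [coeff_modMonomial_of_le _ (by
      rw [Finsupp.single_le_iff]; exact Nat.one_le_iff_ne_zero.2 hm), coeff_zero]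

lemma exists_mem_support_genericCurve {f1 f2 : P2} (h : IsRelPrime f1 f2) :
    ∃ m ∈ (genericCurve f1 f2).support, m 1 = 0 := by
  by_contra! hc
  have hz : ∀ m : Fin 2 →₀ ℕ, m 1 = 0 → coeff m f1 = 0 ∧ coeff m f2 = 0 := fun m hm =>
    (coeff_genericCurve_eq_zero_iff f1 f2 m).1 (notMem_support_iff.1 fun hs => hc m hs hm)
  have hu : IsUnit (X 1 : P2) :=
    h (X_one_dvd_of_coeff_eq_zero fun m hm => (hz m hm).1)
      (X_one_dvd_of_coeff_eq_zero fun m hm => (hz m hm).2)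
  simpa using hu.map (MvPolynomial.eval (0 : Fin 2 → ℂ))

/-- **Theorem 4.2.** Let `X = A ∂/∂x + B ∂/∂y` be an algebraically integrable
planar vector field with `X ≠ c·∂/∂y`, let `f1/f2` be a primitive rational first
integral of `X`, let `g = α·f1 + β·f2` be the generic algebraic invariant curve
and, for `δ ∈ ℕ`, let `G_δ` be the `δ`-bihomogenization of `g`.  Then there is a
`δ1 ∈ ℕ` such that: (i) for every `δ > δ1` and `(y0,y1) ≠ (0,0)`,
`G_δ(0,1,y0,y1) = 0` forces `y0 = 0`; (ii) for every `δ < δ1`,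
`G_δ(0,1,1,0) = 0`; and (iii) `G_{δ1}(0,1,1,0) ≠ 0`. -/
theorem exists_delta1_dicritical (A B f1 f2 : P2)
    (hco : IsRelPrime A B) (hne : ¬ (A = 0 ∧ B = 0))
    (hdy : ¬ (A = 0 ∧ ∃ c : ℂ, c ≠ 0 ∧ B = C c))
    (hfi : IsPrimitiveFI A B f1 f2) :
    ∃ δ1 : ℕ,
      (∀ δ : ℕ, δ1 < δ → ∀ y0 y1 : Kab, ¬ (y0 = 0 ∧ y1 = 0) →
        MvPolynomial.eval ![(0 : Kab), 1, y0, y1] (bihom δ (genericCurve f1 f2)) = 0 →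
          y0 = 0) ∧
      (∀ δ : ℕ, δ < δ1 →
        MvPolynomial.eval ![(0 : Kab), 1, 1, 0] (bihom δ (genericCurve f1 f2)) = 0) ∧
      MvPolynomial.eval ![(0 : Kab), 1, 1, 0] (bihom δ1 (genericCurve f1 f2)) ≠ 0 := by
  obtain ⟨δ1, h1, h2, h3⟩ :=
    exists_delta1_of_exists_mem_support _ (exists_mem_support_genericCurve hfi.2.1)
  exact ⟨δ1, fun δ hδ y0 y1 _ => h1 δ hδ y0 y1, h2, h3⟩


end
end

section
/- Let X = A·∂/∂x + B·∂/∂y (A, B ∈ ℂ[x,y] coprime, not both zero) be an algebraically integrable planar polynomial vector field such that X ≠ c·∂/∂y and X ≠ c·∂/∂x for all c ∈ ℂ\{0}, with primitive rational first integral f = f1/f2 and S = supp(f1) ∪ supp(f2). If δ1 = 0, then the degree of f, i.e. max(deg f1, deg f2), is at most (1+δ'1)·d_x^0 + d_y^0; symmetrically, if δ'1 = 0, then max(deg f1, deg f2) is at most (1+δ1)·d_y^0 + d_x^0. -/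
open MvPolynomial

noncomputable section

/-- The support of a bivariate polynomial, as a set of pairs of exponents. -/
def supp2 (p : P2) : Set (ℕ × ℕ) :=
  {ij | coeff (Finsupp.single 0 ij.1 + Finsupp.single 1 ij.2) p ≠ 0}

/-- `S = supp f1 ∪ supp f2`, the support of the generic invariant curve `α f1 + β f2`. -/
def Ssupp (f1 f2 : P2) : Set (ℕ × ℕ) := supp2 f1 ∪ supp2 f2

/-- `d_x^0`: the degree of `g(x,0)`. -/
def dx0 (f1 f2 : P2) : ℕ := sSup {i | (i, 0) ∈ Ssupp f1 f2}

/-- `d_y^0`: the degree of `g(0,y)`. -/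
def dy0 (f1 f2 : P2) : ℕ := sSup {j | (0, j) ∈ Ssupp f1 f2}

/-- `δ1`: the least `n` such that `i ≤ d_x^0 + n·j` for every `(i,j) ∈ S` with `j > 0`. -/
def delta1 (f1 f2 : P2) : ℕ :=
  sInf {n | ∀ i j : ℕ, (i, j) ∈ Ssupp f1 f2 → 0 < j → i ≤ dx0 f1 f2 + n * j}

/-- `δ'1`: the least `n` such that `j ≤ d_y^0 + n·i` for every `(i,j) ∈ S` with `i > 0`. -/
def delta1' (f1 f2 : P2) : ℕ :=
  sInf {n | ∀ i j : ℕ, (i, j) ∈ Ssupp f1 f2 → 0 < i → j ≤ dy0 f1 f2 + n * i}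

theorem add_le_totalDegree_of_mem_Ssupp {f1 f2 : P2} {i j : ℕ} (h : (i, j) ∈ Ssupp f1 f2) :
    i + j ≤ max f1.totalDegree f2.totalDegree := by
  have aux : ∀ p : P2, (i, j) ∈ supp2 p → i + j ≤ p.totalDegree := fun p hp => by
    have := le_totalDegree (mem_support_iff.mpr hp)
    rw [Finsupp.sum_fintype _ _ (fun _ => rfl), Fin.sum_univ_two] at this
    simpa using this
  exact h.elim (fun h => le_max_of_le_left (aux _ h)) (fun h => le_max_of_le_right (aux _ h))

theorem totalDegree_le_of_forall_mem_Ssupp {f1 f2 : P2} {N : ℕ}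
    (h : ∀ i j : ℕ, (i, j) ∈ Ssupp f1 f2 → i + j ≤ N) :
    max f1.totalDegree f2.totalDegree ≤ N := by
  have aux : ∀ p : P2, supp2 p ⊆ Ssupp f1 f2 → p.totalDegree ≤ N := fun p hp => by
    refine Finset.sup_le fun m hm => ?_
    rw [Finsupp.sum_fintype _ _ (fun _ => rfl), Fin.sum_univ_two]
    refine h _ _ (hp ?_)
    have hm' : Finsupp.single 0 (m 0) + Finsupp.single 1 (m 1) = m := by
      ext k
      fin_cases k <;> simp
    simpa only [supp2, Set.mem_ofPred_eq, hm'] using mem_support_iff.mp hm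
  exact max_le (aux _ Set.subset_union_left) (aux _ Set.subset_union_right)

theorem le_dx0 {f1 f2 : P2} {i : ℕ} (h : (i, 0) ∈ Ssupp f1 f2) : i ≤ dx0 f1 f2 :=
  le_csSup ⟨_, fun _ hk => add_le_totalDegree_of_mem_Ssupp hk⟩ h

theorem le_dy0 {f1 f2 : P2} {j : ℕ} (h : (0, j) ∈ Ssupp f1 f2) : j ≤ dy0 f1 f2 :=
  le_csSup ⟨_, fun k hk => (Nat.le_add_left k 0).trans (add_le_totalDegree_of_mem_Ssupp hk)⟩ h

theorem le_dx0_add_delta1_mul {f1 f2 : P2} {i j : ℕ} (h : (i, j) ∈ Ssupp f1 f2) :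
    i ≤ dx0 f1 f2 + delta1 f1 f2 * j := by
  obtain rfl | hj := j.eq_zero_or_pos
  · simpa using le_dx0 h
  · refine Nat.sInf_mem (s := {n | ∀ i j : ℕ, (i, j) ∈ Ssupp f1 f2 → 0 < j →
      i ≤ dx0 f1 f2 + n * j}) ⟨max f1.totalDegree f2.totalDegree, fun i j hij hj => ?_⟩ i j h hj
    have := add_le_totalDegree_of_mem_Ssupp hij
    have := Nat.le_mul_of_pos_right (max f1.totalDegree f2.totalDegree) hj
    omega

theorem le_dy0_add_delta1'_mul {f1 f2 : P2} {i j : ℕ} (h : (i, j) ∈ Ssupp f1 f2) :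
    j ≤ dy0 f1 f2 + delta1' f1 f2 * i := by
  obtain rfl | hi := i.eq_zero_or_pos
  · simpa using le_dy0 h
  · refine Nat.sInf_mem (s := {n | ∀ i j : ℕ, (i, j) ∈ Ssupp f1 f2 → 0 < i →
      j ≤ dy0 f1 f2 + n * i}) ⟨max f1.totalDegree f2.totalDegree, fun i j hij hi => ?_⟩ i j h hi
    have := add_le_totalDegree_of_mem_Ssupp hij
    have := Nat.le_mul_of_pos_right (max f1.totalDegree f2.totalDegree) hi
    omega

/-- **Corollary 5.3.** If `δ1 = 0` then the degree of a primitive rational first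
integral of `X` is at most `(1+δ'1)·d_x^0 + d_y^0`; symmetrically, if `δ'1 = 0`
then it is at most `(1+δ1)·d_y^0 + d_x^0`. -/
theorem degree_bound_of_delta_zero (A B f1 f2 : P2)
    (hco : IsRelPrime A B) (hne : ¬ (A = 0 ∧ B = 0))
    (hdy : ¬ (A = 0 ∧ ∃ c : ℂ, c ≠ 0 ∧ B = C c))
    (hdx : ¬ (B = 0 ∧ ∃ c : ℂ, c ≠ 0 ∧ A = C c))
    (hfi : IsPrimitiveFI A B f1 f2) :
    (delta1 f1 f2 = 0 →
      max f1.totalDegree f2.totalDegree ≤ (1 + delta1' f1 f2) * dx0 f1 f2 + dy0 f1 f2) ∧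
    (delta1' f1 f2 = 0 →
      max f1.totalDegree f2.totalDegree ≤ (1 + delta1 f1 f2) * dy0 f1 f2 + dx0 f1 f2) := by
  refine ⟨fun h0 => ?_, fun h0 => ?_⟩ <;>
    refine totalDegree_le_of_forall_mem_Ssupp fun i j hij => ?_ <;>
    have hi := le_dx0_add_delta1_mul hij <;>
    have hj := le_dy0_add_delta1'_mul hij
  · rw [h0, zero_mul, add_zero] at hi
    have := Nat.mul_le_mul_left (delta1' f1 f2) hi
    linarith
  · rw [h0, zero_mul, add_zero] at hj
    have := Nat.mul_le_mul_left (delta1 f1 f2) hj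
    linarith

end
end

section
/- Let X = A·∂/∂x + B·∂/∂y (A, B ∈ ℂ[x,y] coprime, not both zero) be an algebraically integrable planar polynomial vector field. If f = f1/f2 and h = h1/h2 are both primitive rational first integrals of X, then supp(f1) ∪ supp(f2) = supp(h1) ∪ supp(h2); in particular, the Newton polytope of the generic algebraic invariant curve of X does not depend on the choice of primitive rational first integral. -/
open MvPolynomial

noncomputable section

open IntermediateField in
/-- Two algebraically dependent elements of a domain that admits a homomorphism to `K(X)` under
which one of them stays transcendental generate, in any field containing the domain, a
subfield of a simple extension of `K`. -/
theorem exists_mem_adjoin_simple_of_ratFunc {K L M : Type*} [Field K] [CommRing L] [IsDomain L]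
    [Algebra K L] [Field M] [Algebra K M] (i : L →ₐ[K] M) (hi : Function.Injective i)
    (j : L →ₐ[K] RatFunc K) (F H : L) (hj : Transcendental K (j F))
    (dep : ¬ AlgebraicIndependent K ![F, H]) : ∃ g : M, i F ∈ K⟮g⟯ ∧ i H ∈ K⟮g⟯ := by
  have hF : Transcendental K F := fun h ↦ hj (h.algHom j)
  have hH : IsAlgebraic (Algebra.adjoin K {F}) H := by
    by_contra hH
    apply dep
    have := (AlgebraicIndependent.iff_transcendental_adjoin_image (x := ![F, H]) (R := K) 1).2
    apply this
    refine ⟨?_, ?_⟩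
    · have : Subsingleton {j : Fin 2 // j ≠ 1} := ⟨by decide⟩
      exact (algebraicIndependent_singleton_iff (⟨0, by decide⟩ : {j : Fin 2 // j ≠ 1})).2 hF
    · have : ({1}ᶜ : Set (Fin 2)) = {0} := by ext k; fin_cases k <;> simp
      rw [this, Set.image_singleton]
      exact hH
  let S := Algebra.adjoin K {F, H}
  have halg : ∀ s ∈ S, IsAlgebraic (Algebra.adjoin K {F}) s := by
    intro s hs
    induction hs using Algebra.adjoin_induction with
    | mem x hx =>
      rcases hx with rfl | rfl
      · exact isAlgebraic_algebraMap (⟨x, Algebra.subset_adjoin rfl⟩ : Algebra.adjoin K {x})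
      · exact hH
    | algebraMap r =>
      exact isAlgebraic_algebraMap (algebraMap K (Algebra.adjoin K {F}) r)
    | add x y _ _ hx hy => exact hx.add hy
    | mul x y _ _ hx hy => exact hx.mul hy
  have hjS : Function.Injective (j.comp S.val) := by
    rw [injective_iff_map_eq_zero]
    rintro ⟨s, hs⟩ h0
    by_contra hne
    have hs0 : s ≠ 0 := fun h ↦ hne (Subtype.ext h)
    obtain ⟨⟨r, hr⟩, hr0, hdvd⟩ := (halg s hs).exists_nonzero_dvd (mem_nonZeroDivisors_of_ne_zero hs0)
    obtain ⟨t, ht⟩ := hdvd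
    change r = s * t at ht
    have hjr : j r = 0 := by
      rw [ht, map_mul, show j s = 0 from h0, zero_mul]
    rw [Algebra.adjoin_singleton_eq_range_aeval] at hr
    obtain ⟨p, rfl⟩ := hr
    have hp : p = 0 := by
      by_contra hp
      exact hj ⟨p, hp, by simpa [Polynomial.aeval_algHom_apply] using hjr⟩
    exact hr0 (Subtype.ext (by simp [hp]))
  have hiS : Function.Injective (i.comp S.val) := hi.comp Subtype.val_injective
  let i' : FractionRing S →ₐ[K] M :=
    IsFractionRing.liftAlgHom (g := i.comp S.val) hiS
  let j' : FractionRing S →ₐ[K] RatFunc K := IsFractionRing.liftAlgHom (g := j.comp S.val) hjS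
  obtain ⟨g, hg⟩ := (RatFunc.Luroth.generator_mem (E := j'.fieldRange))
  have key : ∀ x : FractionRing S, i' x ∈ K⟮i' g⟯ := by
    intro x
    have hx : j' x ∈ K⟮RatFunc.Luroth.generator j'.fieldRange⟯ := by
      rw [← RatFunc.Luroth.eq_adjoin_generator]
      exact ⟨x, rfl⟩
    rw [← hg] at hx
    change j' x ∈ K⟮j' g⟯ at hx
    rw [← Set.image_singleton, ← IntermediateField.adjoin_map] at hx ⊢
    obtain ⟨y, hy, hyx⟩ := hx
    exact ⟨y, hy, by rw [show y = x from j'.injective hyx]; rfl⟩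
  refine ⟨i' g, ?_, ?_⟩
  · have := key (algebraMap S _ ⟨F, Algebra.subset_adjoin (by simp)⟩)
    rwa [show i' (algebraMap S _ ⟨F, _⟩) = i F from
      IsFractionRing.lift_algebraMap (g := (i.comp S.val).toRingHom) hiS _] at this
  · have := key (algebraMap S _ ⟨H, Algebra.subset_adjoin (by simp)⟩)
    rwa [show i' (algebraMap S _ ⟨H, _⟩) = i H from
      IsFractionRing.lift_algebraMap (g := (i.comp S.val).toRingHom) hiS _] at this

/-- A derivation of a field of characteristic zero that vanishes on a subalgebra vanishes on
every element algebraic over that subalgebra. -/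
theorem Derivation.eq_zero_of_isAlgebraic {K F : Type*} [Field K] [CharZero K] [Field F]
    [Algebra K F] (D : Derivation K F F) {S : Subalgebra K F} (hS : ∀ s ∈ S, D s = 0) {x : F}
    (hx : IsAlgebraic S x) : D x = 0 := by
  obtain ⟨p₀, hp₀, hpx₀⟩ := hx
  have hex : ∃ n, ∃ p : Polynomial S, p ≠ 0 ∧ Polynomial.aeval x p = 0 ∧ p.natDegree = n :=
    ⟨_, p₀, hp₀, hpx₀, rfl⟩
  classical
  obtain ⟨p, hp, hpx, hn⟩ := Nat.find_spec hex
  let D' : Derivation S F F := Derivation.mk' (R := S)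
    { toFun := D
      map_add' := D.map_add
      map_smul' := fun s y ↦ by
        have h : D (algebraMap S F s) = 0 := hS _ s.2
        rw [Algebra.smul_def, D.leibniz, h, smul_zero, add_zero, smul_eq_mul, RingHom.id_apply,
          Algebra.smul_def] }
    (fun a b ↦ D.leibniz a b)
  have h := D'.map_aeval p x
  rw [hpx, map_zero, smul_eq_mul] at h
  rcases mul_eq_zero.1 h.symm with h' | h'
  · exfalso
    have hchar : CharZero F := charZero_of_injective_algebraMap (algebraMap K F).injective
    by_cases hd : p.natDegree = 0
    · rw [Polynomial.eq_C_of_natDegree_eq_zero hd] at hpx hp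
      apply hp
      simp only [Polynomial.aeval_C] at hpx
      rw [show p.coeff 0 = 0 from Subtype.ext hpx, Polynomial.C_0]
    · refine Nat.find_min hex (m := p.derivative.natDegree) ?_ ⟨_, ?_, h', rfl⟩
      · rw [← hn]
        exact Polynomial.natDegree_derivative_lt hd
      · exact fun h0 ↦ hd (Polynomial.derivative_eq_zero.1 h0)
  · exact h'

/-- Kronecker substitution `x ↦ t`, `y ↦ t ^ N`. -/
def kronecker (N : ℕ) : P2 →ₐ[ℂ] Polynomial ℂ := aeval ![Polynomial.X, Polynomial.X ^ N]

theorem kronecker_ne_zero {N : ℕ} {p : P2} (hp : p ≠ 0) (hN : p.totalDegree < N) :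
    kronecker N p ≠ 0 := by
  obtain ⟨m, hm⟩ := support_nonempty.2 hp
  have hlt : ∀ k ∈ p.support, k 0 < N := fun k hk ↦ by
    have := le_totalDegree hk
    rw [Finsupp.sum_fintype _ _ (by simp), Fin.sum_univ_two] at this
    omega
  intro h0
  have h1 : (kronecker N p).coeff (m 0 + N * m 1) = p.coeff m := by
    conv_lhs => rw [p.as_sum]
    rw [map_sum, Polynomial.finsetSum_coeff, Finset.sum_eq_single m]
    · simp [kronecker, aeval_monomial, Finsupp.prod_fintype, ← pow_mul, ← pow_add,
        Polynomial.coeff_X_pow]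
    · intro k hk hkm
      simp only [kronecker, aeval_monomial, Finsupp.prod_fintype, ← pow_mul, ← pow_add,
        pow_zero, implies_true, Fin.prod_univ_two, Matrix.cons_val_zero, Matrix.cons_val_one,
        Polynomial.algebraMap_eq, Polynomial.coeff_C_mul, Polynomial.coeff_X_pow]
      rw [if_neg, mul_zero]
      intro h
      apply hkm
      have a := hlt k hk
      have b := hlt m hm
      have e0 : k 0 = m 0 := by
        have := congrArg (· % N) h
        simpa [Nat.mod_eq_of_lt, a, b] using this.symm
      have e1 : k 1 = m 1 := by
        rw [e0] at h
        exact (Nat.eq_of_mul_eq_mul_left (by omega) (Nat.add_left_cancel h)).symm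
      ext t
      fin_cases t
      exacts [e0, e1]
    · exact fun h ↦ (h hm).elim
  rw [h0, Polynomial.coeff_zero] at h1
  exact (mem_support_iff.1 hm) h1.symm

/-- The extension of the vector field `A ∂/∂x + B ∂/∂y` to rational functions. -/
theorem exists_derivation (A B : P2) : ∃ D : Derivation ℂ RF2 RF2, ∀ p : P2,
    D (algebraMap P2 RF2 p) = algebraMap P2 RF2 (A * pderiv 0 p + B * pderiv 1 p) := by
  let D₀ : Derivation ℂ P2 RF2 :=
    (Algebra.linearMap P2 RF2).compDer (A • pderiv 0 + B • pderiv 1)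
  have : Algebra.FormallyEtale P2 RF2 := .of_isLocalization (nonZeroDivisors P2)
  let ℓ : Ω[RF2⁄ℂ] →ₗ[RF2] RF2 :=
    (D₀.liftKaehlerDifferential.liftBaseChange RF2).comp
      (KaehlerDifferential.tensorKaehlerEquivOfFormallyEtale ℂ P2 RF2).symm.toLinearMap
  refine ⟨ℓ.compDer (KaehlerDifferential.D ℂ RF2), fun p ↦ ?_⟩
  simp [ℓ, KaehlerDifferential.tensorKaehlerEquivOfFormallyEtale_symm_D_algebraMap, D₀,
    Algebra.smul_def]

theorem rf_derivation_eq_zero {A B : P2} {D : Derivation ℂ RF2 RF2}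
    (hD : ∀ p : P2, D (algebraMap P2 RF2 p) =
      algebraMap P2 RF2 (A * pderiv 0 p + B * pderiv 1 p))
    {p q : P2} (hq : q ≠ 0) (h : FirstIntegralRep A B p q) : D (rf p q) = 0 := by
  have hq' : algebraMap P2 RF2 q ≠ 0 := by simpa using hq
  have e : rf p q * algebraMap P2 RF2 q = algebraMap P2 RF2 p := div_mul_cancel₀ _ hq'
  have h1 := congrArg D e
  rw [D.leibniz, hD, hD, smul_eq_mul, smul_eq_mul] at h1
  have h2 := congrArg (algebraMap P2 RF2) h
  simp only [map_add, map_mul, map_sub, map_zero] at h1 h2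
  have h3 : algebraMap P2 RF2 q * (algebraMap P2 RF2 q * D (rf p q)) = 0 := by
    rw [← e] at h2
    linear_combination algebraMap P2 RF2 q * h1 + h2
  simpa [hq'] using h3

theorem not_algebraicIndependent_of_firstIntegral {A B p q r s : P2} (hne : ¬ (A = 0 ∧ B = 0))
    (hq : q ≠ 0) (hs : s ≠ 0) (h : FirstIntegralRep A B p q) (h' : FirstIntegralRep A B r s) :
    ¬ AlgebraicIndependent ℂ ![rf p q, rf r s] := by
  intro hind
  obtain ⟨D, hD⟩ := exists_derivation A B
  have : Algebra.IsAlgebraic P2 RF2 := 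
    IsLocalization.isAlgebraic RF2 (nonZeroDivisors P2)
  have hbasis : IsTranscendenceBasis ℂ (algebraMap P2 RF2 ∘ (X : Fin 2 → P2)) :=
    (IsTranscendenceBasis.mvPolynomial (Fin 2) ℂ).algebraMap_comp
  have htr : Algebra.trdeg ℂ RF2 = 2 := by
    have := hbasis.lift_cardinalMk_eq_trdeg
    simpa using this.symm
  have hb : IsTranscendenceBasis ℂ ![rf p q, rf r s] :=
    hind.isTranscendenceBasis_of_lift_trdeg_le_of_finite (by simp [htr])
  have halg := hb.isAlgebraic
  have hzero : ∀ x : RF2, D x = 0 := fun x ↦ by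
    refine D.eq_zero_of_isAlgebraic (fun y hy ↦ ?_) (halg.isAlgebraic x)
    induction hy using Algebra.adjoin_induction with
    | mem y hy =>
      obtain ⟨k, rfl⟩ := hy
      fin_cases k
      exacts [rf_derivation_eq_zero hD hq h, rf_derivation_eq_zero hD hs h']
    | algebraMap c => exact D.map_algebraMap c
    | add a b _ _ ha hb => rw [map_add, ha, hb, add_zero]
    | mul a b _ _ ha hb => rw [D.leibniz, ha, hb, smul_zero, smul_zero, add_zero]
  apply hne
  have h0 := hD (X 0)
  have h1 := hD (X 1)
  rw [hzero] at h0 h1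
  constructor
  · simpa [pderiv_X] using h0.symm
  · simpa [pderiv_X] using h1.symm

theorem algebraMap_P2_C (c : ℂ) : algebraMap P2 RF2 (C c) = algebraMap ℂ RF2 c :=
  (IsScalarTower.algebraMap_apply ℂ P2 RF2 c).symm

theorem isConstRF_rf {p q : P2} (hq : q ≠ 0) {c : ℂ} (h : p = C c * q) : IsConstRF (rf p q) := by
  refine ⟨c, ?_⟩
  have hq' : algebraMap P2 RF2 q ≠ 0 := by simpa using hq
  rw [rf, h, map_mul, mul_div_cancel_right₀ _ hq']

theorem isConstRF_of_isAlgebraic {g : RF2} (hg : IsAlgebraic ℂ g) : IsConstRF g := by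
  have := IntermediateField.isAlgebraic_adjoin_simple hg.isIntegral
  obtain ⟨c, hc⟩ := (IsAlgClosed.algebraMap_bijective_of_isIntegral (k := ℂ)).2
    (IntermediateField.AdjoinSimple.gen ℂ g)
  refine ⟨c, ?_⟩
  rw [algebraMap_P2_C]
  exact (congrArg Subtype.val hc).symm

open IntermediateField in
/-- Dependent fractions, one of them nonconstant, are rational functions of a common fraction. -/
theorem exists_mem_adjoin_simple {p q r s : P2} (hq : q ≠ 0) (hs : s ≠ 0)
    (hp : ¬ IsConstRF (rf p q)) (dep : ¬ AlgebraicIndependent ℂ ![rf p q, rf r s]) :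
    ∃ g : RF2, rf p q ∈ ℂ⟮g⟯ ∧ rf r s ∈ ℂ⟮g⟯ := by
  have hqs : q * s ≠ 0 := mul_ne_zero hq hs
  set N := p.totalDegree + (q * s).totalDegree + q.totalDegree + 1
  let L := Localization.Away (q * s)
  have hM : Submonoid.powers (q * s) ≤ nonZeroDivisors P2 :=
    powers_le_nonZeroDivisors_of_noZeroDivisors hqs
  have : IsDomain L := IsLocalization.isDomain_localization hM
  have hk : kronecker N (q * s) ≠ 0 := kronecker_ne_zero hqs (by omega)
  let i : L →ₐ[ℂ] RF2 := IsLocalization.liftAlgHom (M := Submonoid.powers (q * s))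
    (f := Algebra.algHom ℂ P2 RF2) (fun y ↦ by
      have := nonZeroDivisors.ne_zero (hM y.2)
      exact isUnit_iff_ne_zero.2
        ((map_ne_zero_iff _ (IsFractionRing.injective P2 RF2)).2 this))
  have hi_map : ∀ a, i (algebraMap P2 L a) = algebraMap P2 RF2 a := fun a ↦
    IsLocalization.lift_eq _ _
  have hi : Function.Injective i :=
    (IsLocalization.lift_injective_iff _).2 fun x y ↦ by
      rw [(IsLocalization.injective L hM).eq_iff]
      exact (IsFractionRing.injective P2 RF2).eq_iff.symm
  let j : L →ₐ[ℂ] RatFunc ℂ := IsLocalization.liftAlgHom (M := Submonoid.powers (q * s))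
    (f := (Algebra.algHom ℂ (Polynomial ℂ) (RatFunc ℂ)).comp (kronecker N)) (fun y ↦ by
      obtain ⟨n, hn⟩ := y.2
      have hy : kronecker N y ≠ 0 := by
        rw [← hn, map_pow]
        exact pow_ne_zero n hk
      exact isUnit_iff_ne_zero.2 (RatFunc.algebraMap_ne_zero hy))
  have hj_map : ∀ a, j (algebraMap P2 L a) = algebraMap _ (RatFunc ℂ) (kronecker N a) := fun a ↦
    IsLocalization.lift_eq _ _
  let one : Submonoid.powers (q * s) := ⟨q * s, Submonoid.mem_powers _⟩
  let F : L := IsLocalization.mk' L (p * s) one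
  let H : L := IsLocalization.mk' L (r * q) one
  have hF : F * algebraMap P2 L (q * s) = algebraMap P2 L (p * s) := IsLocalization.mk'_spec L _ one
  have hH : H * algebraMap P2 L (q * s) = algebraMap P2 L (r * q) := IsLocalization.mk'_spec L _ one
  have hq' : algebraMap P2 RF2 q ≠ 0 := by simpa using hq
  have hs' : algebraMap P2 RF2 s ≠ 0 := by simpa using hs
  have hiF : i F = rf p q := by
    have := congrArg i hF
    rw [map_mul, hi_map, hi_map, map_mul, map_mul] at this
    rw [rf, eq_div_iff hq']
    exact mul_right_cancel₀ hs' (by linear_combination this)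
  have hiH : i H = rf r s := by
    have := congrArg i hH
    rw [map_mul, hi_map, hi_map, map_mul, map_mul] at this
    rw [rf, eq_div_iff hs']
    exact mul_right_cancel₀ hq' (by linear_combination this)
  have hjF : Transcendental ℂ (j F) := by
    refine RatFunc.transcendental_of_ne_C _ ?_
    rintro ⟨c, hc⟩
    apply hp
    apply isConstRF_rf hq (c := c)
    by_contra hne
    refine kronecker_ne_zero (N := N) (sub_ne_zero.2 hne) ?_ ?_
    · have h1 := totalDegree_sub p (C c * q)
      have h2 := totalDegree_mul (C c) q
      rw [totalDegree_C] at h2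
      omega
    · have := congrArg j hF
      rw [map_mul, hj_map, hj_map, hc, ← RatFunc.algebraMap_C, ← map_mul] at this
      have := RatFunc.algebraMap_injective ℂ this
      have hks : kronecker N s ≠ 0 := fun h ↦ hk (by rw [map_mul, h, mul_zero])
      have hC : kronecker N (C c) = Polynomial.C c := (kronecker N).commutes c
      refine mul_right_cancel₀ hks ?_
      rw [map_mul, map_mul] at this
      rw [map_sub, map_mul, hC]
      linear_combination -this
  obtain ⟨g, hg⟩ := exists_mem_adjoin_simple_of_ratFunc i hi j F H hjF (fun hind ↦ dep (by
    have := hind.map' (f := i) hi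
    rwa [show i ∘ ![F, H] = ![rf p q, rf r s] by
      ext k
      fin_cases k
      exacts [hiF, hiH]] at this))
  exact ⟨g, by rwa [hiF, hiH] at hg⟩

open IntermediateField in
theorem exists_moebius {f g : RF2} (hf : ¬ IsConstRF f) (hf' : ¬ IsCompositeRF f)
    (hfg : f ∈ ℂ⟮g⟯) : ∃ a b c d : ℂ, algebraMap ℂ RF2 c * g + algebraMap ℂ RF2 d ≠ 0 ∧
      f * (algebraMap ℂ RF2 c * g + algebraMap ℂ RF2 d) =
        algebraMap ℂ RF2 a * g + algebraMap ℂ RF2 b := by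
  have hg : ¬ IsConstRF g := by
    rintro ⟨c, rfl⟩
    rw [algebraMap_P2_C, adjoin_simple_eq_bot_iff.2 (IntermediateField.algebraMap_mem _ c)] at hfg
    obtain ⟨d, hd⟩ := mem_bot.1 hfg
    exact hf ⟨d, by rw [algebraMap_P2_C, hd]⟩
  have hgt : ∀ p : Polynomial ℂ, Polynomial.aeval g p = 0 → p = 0 := fun p h0 ↦ by
    by_contra hp
    exact hg (isConstRF_of_isAlgebraic ⟨p, hp, h0⟩)
  obtain ⟨r, s, hrs⟩ := (mem_adjoin_simple_iff ℂ f).1 hfg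
  have hs : s ≠ 0 := by
    rintro rfl
    exact hf ⟨0, by simp [hrs]⟩
  let u : RatFunc ℂ := algebraMap _ _ r / algebraMap _ _ s
  have hcomp : (algebraMap P2 RF2).comp (C : ℂ →+* P2) = algebraMap ℂ RF2 :=
    RingHom.ext algebraMap_P2_C
  have hfu : f = Polynomial.aeval g u.num / Polynomial.aeval g u.denom := by
    have e : u.num * s = r * u.denom := by
      apply RatFunc.algebraMap_injective ℂ
      have hs' : algebraMap _ (RatFunc ℂ) s ≠ 0 := RatFunc.algebraMap_ne_zero hs
      have hd' : algebraMap _ (RatFunc ℂ) u.denom ≠ 0 :=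
        RatFunc.algebraMap_ne_zero u.denom_ne_zero
      rw [map_mul, map_mul, ← div_eq_div_iff hd' hs', RatFunc.num_div_denom]
    have e' := congrArg (Polynomial.aeval g) e
    rw [map_mul, map_mul] at e'
    rw [hrs, div_eq_div_iff (fun h ↦ hs (hgt _ h)) (fun h ↦ u.denom_ne_zero (hgt _ h)), e']
  have hdeg : max u.num.natDegree u.denom.natDegree ≤ 1 := by
    by_contra! h2
    refine hf' ⟨u, g, hg, h2, ?_⟩
    rw [hcomp]
    exact hfu
  obtain ⟨a, b, hab⟩ := Polynomial.exists_eq_X_add_C_of_natDegree_le_one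
    ((le_max_left _ _).trans hdeg)
  obtain ⟨c, d, hcd⟩ := Polynomial.exists_eq_X_add_C_of_natDegree_le_one
    ((le_max_right _ _).trans hdeg)
  have hden : Polynomial.aeval g u.denom ≠ 0 := fun h ↦ u.denom_ne_zero (hgt _ h)
  have e := (eq_div_iff hden).1 hfu
  rw [hab, hcd] at e
  rw [hcd] at hden
  exact ⟨a, b, c, d, by simpa using hden, by simpa using e⟩

/-- Any primitive rational first integral is a linear fractional transformation of any other. -/
theorem IsPrimitiveFI.exists_linear {A B f1 f2 h1 h2 : P2} (hne : ¬ (A = 0 ∧ B = 0))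
    (hf : IsPrimitiveFI A B f1 f2) (hh : IsPrimitiveFI A B h1 h2) :
    ∃ α β γ δ : ℂ, C γ * f1 + C δ * f2 ≠ 0 ∧
      h1 * (C γ * f1 + C δ * f2) = h2 * (C α * f1 + C β * f2) := by
  obtain ⟨hf2, -, hfc, hfi, hfn⟩ := hf
  obtain ⟨hh2, -, hhc, hhi, hhn⟩ := hh
  obtain ⟨g, hg, hg'⟩ := exists_mem_adjoin_simple hf2 hh2 hfc
    (not_algebraicIndependent_of_firstIntegral hne hf2 hh2 hfi hhi)
  obtain ⟨a, b, c, d, hcd, hab⟩ := exists_moebius hfc hfn hg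
  obtain ⟨a', b', c', d', hcd', hab'⟩ := exists_moebius hhc hhn hg'
  have hf2' : algebraMap P2 RF2 f2 ≠ 0 := by simpa using hf2
  have hh2' : algebraMap P2 RF2 h2 ≠ 0 := by simpa using hh2
  have ef : rf f1 f2 * algebraMap P2 RF2 f2 = algebraMap P2 RF2 f1 := div_mul_cancel₀ _ hf2'
  have eh : rf h1 h2 * algebraMap P2 RF2 h2 = algebraMap P2 RF2 h1 := div_mul_cancel₀ _ hh2'
  have hne0 : algebraMap ℂ RF2 c * rf f1 f2 - algebraMap ℂ RF2 a ≠ 0 := by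
    intro h0
    by_cases hc : c = 0
    · subst hc
      have ha : a = 0 := by simpa using h0
      subst ha
      have hd : d ≠ 0 := by rintro rfl; simp at hcd
      have hd' : algebraMap ℂ RF2 d ≠ 0 := by simpa using hd
      refine hfc ⟨b / d, ?_⟩
      rw [algebraMap_P2_C, map_div₀, eq_div_iff hd']
      simpa using hab
    · have hc' : algebraMap ℂ RF2 c ≠ 0 := by simpa using hc
      refine hfc ⟨a / c, ?_⟩
      rw [algebraMap_P2_C, map_div₀, eq_div_iff hc']
      linear_combination h0
  have inj := IsFractionRing.injective P2 RF2
  have expand : ∀ y z : ℂ, algebraMap P2 RF2 (C y * f1 + C z * f2) =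
      (algebraMap ℂ RF2 y * rf f1 f2 + algebraMap ℂ RF2 z) * algebraMap P2 RF2 f2 := fun y z ↦ by
    rw [map_add, map_mul, map_mul, algebraMap_P2_C, algebraMap_P2_C, ← ef]
    ring
  have hγ : algebraMap ℂ RF2 (d' * c - c' * d) * rf f1 f2 + algebraMap ℂ RF2 (c' * b - d' * a) =
      (algebraMap ℂ RF2 c' * g + algebraMap ℂ RF2 d') *
        (algebraMap ℂ RF2 c * rf f1 f2 - algebraMap ℂ RF2 a) := by
    simp only [map_sub, map_mul]
    linear_combination -algebraMap ℂ RF2 c' * hab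
  have hα : algebraMap ℂ RF2 (b' * c - a' * d) * rf f1 f2 + algebraMap ℂ RF2 (a' * b - b' * a) =
      (algebraMap ℂ RF2 a' * g + algebraMap ℂ RF2 b') *
        (algebraMap ℂ RF2 c * rf f1 f2 - algebraMap ℂ RF2 a) := by
    simp only [map_sub, map_mul]
    linear_combination -algebraMap ℂ RF2 a' * hab
  refine ⟨b' * c - a' * d, a' * b - b' * a, d' * c - c' * d, c' * b - d' * a, fun h0 ↦ ?_, ?_⟩
  · have := congrArg (algebraMap P2 RF2) h0
    rw [expand, hγ, map_zero] at this
    exact mul_ne_zero (mul_ne_zero hcd' hne0) hf2' this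
  · apply inj
    rw [map_mul, map_mul, expand, expand, hγ, hα, ← eh, ← hab']
    ring

theorem IsPrimitiveFI.supp2_subset {A B f1 f2 h1 h2 : P2} (hne : ¬ (A = 0 ∧ B = 0))
    (hf : IsPrimitiveFI A B f1 f2) (hh : IsPrimitiveFI A B h1 h2) :
    supp2 h1 ∪ supp2 h2 ⊆ supp2 f1 ∪ supp2 f2 := by
  obtain ⟨α, β, γ, δ, hQ, hE⟩ := hf.exists_linear hne hh
  obtain ⟨hf2, hfr, -, -, -⟩ := hf
  obtain ⟨hh2, hhr, hhc, -, -⟩ := hh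
  obtain ⟨k, hk⟩ : h2 ∣ C γ * f1 + C δ * f2 := hhr.symm.dvd_of_dvd_mul_left ⟨_, hE⟩
  have hk' : C α * f1 + C β * f2 = h1 * k := mul_left_cancel₀ hh2 (by rw [← hE, hk]; ring)
  have hk0 : k ≠ 0 := by
    rintro rfl
    exact hQ (by rw [hk, mul_zero])
  have hdet : α * δ - β * γ ≠ 0 := by
    intro hdet
    have hdet' : (C α * C δ - C β * C γ : P2) = 0 := by
      rw [← C_mul, ← C_mul, ← C_sub, hdet, C_0]
    have e1 : C δ * h1 = C β * h2 := mul_right_cancel₀ hk0 (by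
      linear_combination -C δ * hk' + C β * hk + f1 * hdet')
    have e2 : C γ * h1 = C α * h2 := mul_right_cancel₀ hk0 (by
      linear_combination -C γ * hk' + C α * hk - f2 * hdet')
    have key : ∀ y z : ℂ, y ≠ 0 → C y * h1 = C z * h2 → False := fun y z hy e ↦ by
      refine hhc (isConstRF_rf hh2 (c := y⁻¹ * z) ?_)
      rw [C_mul, mul_assoc, ← e, ← mul_assoc, ← C_mul, inv_mul_cancel₀ hy, C_1, one_mul]
    by_cases hγ : γ = 0
    · by_cases hδ : δ = 0
      · exact hQ (by simp [hγ, hδ])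
      · exact key _ _ hδ e1
    · exact key _ _ hγ e2
  have hdet' : IsUnit (C (α * δ - β * γ) : P2) := (isUnit_iff_ne_zero.2 hdet).map C
  have hku : IsUnit k := by
    refine hfr ?_ ?_
    · refine hdet'.dvd_mul_left.1 ⟨C δ * h1 - C β * h2, ?_⟩
      simp only [C_sub, C_mul]
      linear_combination C δ * hk' - C β * hk
    · refine hdet'.dvd_mul_left.1 ⟨C α * h2 - C γ * h1, ?_⟩
      simp only [C_sub, C_mul]
      linear_combination C α * hk - C γ * hk'
  obtain ⟨c, hc, rfl⟩ := MvPolynomial.isUnit_iff_eq_C_of_isReduced.1 hku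
  have hc0 : c ≠ 0 := hc.ne_zero
  have coeffs : ∀ (y z : ℂ) (p : P2), C y * f1 + C z * f2 = C c * p →
      supp2 p ⊆ supp2 f1 ∪ supp2 f2 := by
    rintro y z p hp ij hij
    by_contra hnot
    simp only [supp2, Set.mem_union, Set.mem_ofPred_eq, not_or, not_not] at hnot hij
    have := congrArg (coeff (Finsupp.single 0 ij.1 + Finsupp.single 1 ij.2)) hp
    rw [coeff_add, coeff_C_mul, coeff_C_mul, coeff_C_mul, hnot.1, hnot.2] at this
    simp [hc0, hij] at this
  exact Set.union_subset
    (coeffs _ _ _ (hk'.trans (mul_comm _ _))) (coeffs _ _ _ (hk.trans (mul_comm _ _)))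

/-- **Well-definedness of the Newton polytope (Definition 5.1).** Any two primitive
rational first integrals of an algebraically integrable planar vector field have the
same joint support `supp(f1) ∪ supp(f2)`; in particular, the Newton polytope of the
generic algebraic invariant curve does not depend on the choice of primitive
rational first integral. -/
theorem support_generic_curve_well_defined (A B f1 f2 h1 h2 : P2)
    (hco : IsRelPrime A B) (hne : ¬ (A = 0 ∧ B = 0))
    (hfi : IsPrimitiveFI A B f1 f2) (hhi : IsPrimitiveFI A B h1 h2) :
    supp2 f1 ∪ supp2 f2 = supp2 h1 ∪ supp2 h2 ∧
      convexHull ℝ ((fun ij : ℕ × ℕ => ((ij.1 : ℝ), (ij.2 : ℝ))) '' (supp2 f1 ∪ supp2 f2)) =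
        convexHull ℝ ((fun ij : ℕ × ℕ => ((ij.1 : ℝ), (ij.2 : ℝ))) '' (supp2 h1 ∪ supp2 h2)) := by
  have h : supp2 f1 ∪ supp2 f2 = supp2 h1 ∪ supp2 h2 :=
    (hhi.supp2_subset hne hfi).antisymm (hfi.supp2_subset hne hhi)
  exact ⟨h, by rw [h]⟩

end
end

section
/- Let K be a field, δ ∈ ℕ, and g = Σ g_{ij} x^i y^j ∈ K[x,y] a nonzero polynomial with g(x,0) ≠ 0; set d_x^0 = deg g(x,0) and let G_δ be the δ-bihomogenization of g. Then G_δ(0,1,1,0) ≠ 0 if and only if every (i,j) with g_{ij} ≠ 0 and j > 0 satisfies i ≤ d_x^0 + δ·j; moreover, when this condition holds, G_δ(0,1,1,0) equals the (nonzero) coefficient of x^{d_x^0} in g(x,0), and when it fails, G_δ(0,1,1,0) = 0. -/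
open MvPolynomial

noncomputable section

variable {K : Type*} [Field K]

/-- The coefficients of `g(x,0)` are the coefficients of `g` on the pure powers of `x`. -/
theorem coeff_aeval_X_zero (g : MvPolynomial (Fin 2) K) (n : ℕ) :
    (aeval ![(Polynomial.X : Polynomial K), 0] g).coeff n = coeff (Finsupp.single 0 n) g := by
  induction g using MvPolynomial.induction_on' with
  | add p q hp hq => simp [hp, hq]
  | monomial u a =>
    have hu : u = Finsupp.single 0 n ↔ u 0 = n ∧ u 1 = 0 := by
      simp [Finsupp.ext_iff, Fin.forall_fin_two]
    rw [aeval_monomial, Finsupp.prod_fintype _ _ (by simp), Fin.prod_univ_two, coeff_monomial,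
      ← Polynomial.C_eq_algebraMap, Polynomial.coeff_C_mul]
    simp only [hu, Matrix.cons_val_zero, Matrix.cons_val_one]
    by_cases h1 : u 1 = 0 <;> simp [h1, Polynomial.coeff_X_pow, eq_comm]

/-- Only the pure powers `x^i` of maximal weight `i = a` contribute to `G_δ(0,1,1,0)`. -/
theorem eval_bihom_0110 (δ : ℕ) (g : MvPolynomial (Fin 2) K) :
    MvPolynomial.eval ![(0 : K), 1, 1, 0] (bihom δ g) =
      ∑ m ∈ g.support,
        if m 1 = 0 ∧ ∀ m' ∈ g.support, m' 0 ≤ m 0 + δ * m' 1 then coeff m g else 0 := by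
  rw [bihom, map_sum]
  refine Finset.sum_congr rfl fun m _ => ?_
  rw [eval_monomial, Finsupp.prod_fintype _ _ (by simp), Fin.prod_univ_four]
  by_cases h1 : m 1 = 0
  · have hsup : (g.support.sup fun m' => m' 0 - δ * m' 1) - m 0 = 0 ↔
        m 1 = 0 ∧ ∀ m' ∈ g.support, m' 0 ≤ m 0 + δ * m' 1 := by
      simp [h1, Nat.sub_eq_zero_iff_le]
    rw [← if_congr hsup rfl rfl]
    simp [bihomExp, h1, zero_pow_eq]
  · simp [bihomExp, h1]

/-- The value `G_δ(0,1,1,0)` in terms of the degree of `g(x,0)`. -/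
theorem eval_bihom_0110_eq_ite (δ : ℕ) (g : MvPolynomial (Fin 2) K)
    (hgx : aeval ![(Polynomial.X : Polynomial K), 0] g ≠ 0)
    (d : ℕ) (hd : d = (aeval ![(Polynomial.X : Polynomial K), 0] g).natDegree) :
    MvPolynomial.eval ![(0 : K), 1, 1, 0] (bihom δ g) =
      if ∀ m ∈ g.support, 0 < m 1 → m 0 ≤ d + δ * m 1 then coeff (Finsupp.single 0 d) g
      else 0 := by
  have eq_single (m : Fin 2 →₀ ℕ) (h1 : m 1 = 0) : m = Finsupp.single 0 (m 0) := by
    simp [Finsupp.ext_iff, Fin.forall_fin_two, h1]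
  have le_d (m : Fin 2 →₀ ℕ) (hm : m ∈ g.support) (h1 : m 1 = 0) : m 0 ≤ d := by
    rw [hd]
    apply Polynomial.le_natDegree_of_ne_zero
    rw [coeff_aeval_X_zero, ← eq_single m h1]
    exact mem_support_iff.mp hm
  have hdmem : Finsupp.single 0 d ∈ g.support := by
    rw [mem_support_iff, ← coeff_aeval_X_zero, hd]
    exact Polynomial.leadingCoeff_ne_zero.mpr hgx
  have hiff : (∀ m ∈ g.support, 0 < m 1 → m 0 ≤ d + δ * m 1) ↔
      ∀ m ∈ g.support, m 0 ≤ d + δ * m 1 := by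
    refine ⟨fun h m hm => ?_, fun h m hm _ => h m hm⟩
    rcases Nat.eq_zero_or_pos (m 1) with h1 | h1
    · exact (le_d m hm h1).trans (Nat.le_add_right _ _)
    · exact h m hm h1
  rw [eval_bihom_0110, Finset.sum_eq_single_of_mem _ hdmem]
  · exact if_congr (by rw [hiff]; simp) rfl rfl
  · intro m hm hne
    refine if_neg fun ⟨h1, h⟩ => hne ?_
    have hle : d ≤ m 0 := by simpa using h _ hdmem
    rw [eq_single m h1, (le_d m hm h1).antisymm hle]

/-- **Cases 1–2 in the proof of Theorem 4.2.** For `g ≠ 0` with `g(x,0) ≠ 0` and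
`d_x^0 = deg g(x,0)`: the value `G_δ(0,1,1,0)` is nonzero precisely when every
`(i,j)` in the support of `g` with `j > 0` satisfies `i ≤ d_x^0 + δ·j`; when this
condition holds, `G_δ(0,1,1,0)` equals the (nonzero) coefficient of `x^{d_x^0}`
in `g(x,0)`, and when it fails, `G_δ(0,1,1,0) = 0`. -/
theorem bihom_eval_0110 (δ : ℕ) (g : MvPolynomial (Fin 2) K) (hg : g ≠ 0)
    (hgx : aeval ![(Polynomial.X : Polynomial K), 0] g ≠ 0)
    (d : ℕ) (hd : d = (aeval ![(Polynomial.X : Polynomial K), 0] g).natDegree) :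
    (MvPolynomial.eval ![(0 : K), 1, 1, 0] (bihom δ g) ≠ 0 ↔
      ∀ m ∈ g.support, 0 < m 1 → m 0 ≤ d + δ * m 1) ∧
    ((∀ m ∈ g.support, 0 < m 1 → m 0 ≤ d + δ * m 1) →
      MvPolynomial.eval ![(0 : K), 1, 1, 0] (bihom δ g) =
        (aeval ![(Polynomial.X : Polynomial K), 0] g).coeff d ∧
        (aeval ![(Polynomial.X : Polynomial K), 0] g).coeff d ≠ 0) ∧
    (¬ (∀ m ∈ g.support, 0 < m 1 → m 0 ≤ d + δ * m 1) →
      MvPolynomial.eval ![(0 : K), 1, 1, 0] (bihom δ g) = 0) := by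
  have hne : (aeval ![(Polynomial.X : Polynomial K), 0] g).coeff d ≠ 0 := by
    rw [hd]
    exact Polynomial.leadingCoeff_ne_zero.mpr hgx
  rw [eval_bihom_0110_eq_ite δ g hgx d hd, ← coeff_aeval_X_zero]
  split_ifs with h
  · exact ⟨iff_of_true hne h, fun _ => ⟨rfl, hne⟩, fun hn => absurd h hn⟩
  · exact ⟨iff_of_false (not_not.mpr rfl) h, fun hh => absurd hh h, fun _ => rfl⟩

end
end

section
/- The planar polynomial vector field X = (x² + xy − y³)·∂/∂x + (xy + y² + 5x³y)·∂/∂y (i.e., the vector field defined by the differential 1-form ω = (xy + y² + 5x³y)dx + (−x² − xy + y³)dy) is not algebraically integrable: there is no nonconstant rational function f ∈ ℂ(x,y) such that (x² + xy − y³)·∂f/∂x + (xy + y² + 5x³y)·∂f/∂y = 0. -/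
open MvPolynomial

noncomputable section

namespace Polynomial

/-- Leading coefficients in the lowest-order part, along the invariant line `y = 0`, of the
first-integral equation force equal vanishing orders and equal degrees. -/
theorem natDegree_eq_of_wronskian {a b : ℕ} {p q : ℂ[X]} (hp : p ≠ 0) (hq : q ≠ 0)
    (h : q * (X ^ 2 * derivative p + (a : ℂ[X]) * ((X + 5 * X ^ 3) * p))
      = p * (X ^ 2 * derivative q + (b : ℂ[X]) * ((X + 5 * X ^ 3) * q))) :
    a = b ∧ p.natDegree = q.natDegree := by
  have hlp : p.leadingCoeff ≠ 0 := leadingCoeff_ne_zero.mpr hp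
  have hlq : q.leadingCoeff ≠ 0 := leadingCoeff_ne_zero.mpr hq
  have hE (r : ℂ[X]) : (X * derivative r).natDegree ≤ r.natDegree := by
    refine natDegree_le_iff_coeff_eq_zero.mpr fun N hN => ?_
    obtain ⟨k, rfl⟩ : ∃ k, N = k + 1 := ⟨N - 1, by omega⟩
    rw [coeff_X_mul, coeff_derivative, coeff_eq_zero_of_natDegree_lt hN, zero_mul]
  have hEc (r : ℂ[X]) : (X * derivative r).coeff r.natDegree
      = r.natDegree * r.leadingCoeff := by
    rcases hr : r.natDegree with _ | k
    · simp
    · rw [coeff_X_mul, coeff_derivative, leadingCoeff, hr]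
      push_cast
      ring
  have h1 : q * (X * derivative p) - p * (X * derivative q)
      + C ((a : ℂ) - b) * (p * q) + C (5 * ((a : ℂ) - b)) * (p * q) * X ^ 2 = 0 := by
    apply mul_left_cancel₀ (X_ne_zero (R := ℂ))
    simp only [map_sub, map_mul, map_natCast, map_ofNat]
    linear_combination h
  have hqp : (q * (X * derivative p)).natDegree ≤ q.natDegree + p.natDegree :=
    natDegree_mul_le_of_le le_rfl (hE p)
  have hpq : (p * (X * derivative q)).natDegree ≤ p.natDegree + q.natDegree :=
    natDegree_mul_le_of_le le_rfl (hE q)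
  have hpq' : (p * q).natDegree ≤ p.natDegree + q.natDegree := natDegree_mul_le
  have hab : a = b := by
    have h2 := congrArg (coeff · (p.natDegree + q.natDegree + 2)) h1
    simp only [coeff_add, coeff_sub, coeff_mul_X_pow, coeff_C_mul, coeff_mul_degree_add_degree,
      coeff_zero] at h2
    rw [coeff_eq_zero_of_natDegree_lt (by omega), coeff_eq_zero_of_natDegree_lt (by omega),
      coeff_eq_zero_of_natDegree_lt (p := p * q) (by omega)] at h2
    have h3 : (a : ℂ) - b = 0 := by simpa [hp, hq] using h2
    exact_mod_cast sub_eq_zero.mp h3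
  refine ⟨hab, ?_⟩
  subst hab
  have h2 := congrArg (coeff · (p.natDegree + q.natDegree)) h1
  simp only [sub_self, mul_zero, map_zero, zero_mul, add_zero, coeff_sub, coeff_zero] at h2
  rw [coeff_mul_add_eq_of_natDegree_le le_rfl (hE q), add_comm p.natDegree,
    coeff_mul_add_eq_of_natDegree_le le_rfl (hE p), hEc, hEc, coeff_natDegree,
    coeff_natDegree] at h2
  have h3 : ((p.natDegree : ℂ) - q.natDegree) * (p.leadingCoeff * q.leadingCoeff) = 0 := by
    linear_combination h2
  have h4 := (mul_eq_zero.mp h3).resolve_right (mul_ne_zero hlp hlq)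
  exact_mod_cast sub_eq_zero.mp h4

/-- The derivation `∂/∂x` of `ℂ[x][y]`, acting on coefficients. -/
def coeffDeriv : Derivation ℂ ℂ[X][X] ℂ[X][X] :=
  PolynomialModule.equivPolynomialSelf.compDer (derivative' (R := ℂ)).mapCoeffs

theorem coeff_coeffDeriv (P : ℂ[X][X]) (n : ℕ) :
    (coeffDeriv P).coeff n = derivative (P.coeff n) :=
  rfl

/-- The vector field of the example as a derivation of `ℂ[x][y]`. -/
def exampleField : Derivation ℂ ℂ[X][X] ℂ[X][X] :=
  (C X ^ 2 + C X * X - X ^ 3 : ℂ[X][X]) • coeffDeriv +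
    (C X * X + X ^ 2 + 5 * C X ^ 3 * X : ℂ[X][X]) •
      (Polynomial.derivative' (R := ℂ[X])).restrictScalars ℂ

theorem exampleField_apply (P : ℂ[X][X]) : exampleField P =
    (C X ^ 2 + C X * X - X ^ 3) * coeffDeriv P +
      (C X * X + X ^ 2 + 5 * C X ^ 3 * X) * derivative P :=
  rfl

theorem exampleField_X : exampleField X = X * (C X + X + 5 * C X ^ 3 : ℂ[X][X]) := by
  have h : coeffDeriv X = 0 := by
    ext1 n
    rw [coeff_coeffDeriv, coeff_X]
    split_ifs <;> simp
  rw [exampleField_apply, h, derivative_X]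
  ring

theorem exampleField_X_pow_mul (a : ℕ) (P : ℂ[X][X]) : exampleField (X ^ a * P) =
    X ^ a * (exampleField P + (a : ℂ[X][X]) * ((C X + X + 5 * C X ^ 3) * P)) := by
  rw [Derivation.leibniz, Derivation.leibniz_pow, exampleField_X]
  rcases a with _ | a
  · simp
  · simp only [smul_eq_mul, nsmul_eq_mul, add_tsub_cancel_right]
    ring

theorem eval_zero_exampleField (P : ℂ[X][X]) :
    (exampleField P).eval 0 = X ^ 2 * derivative (P.eval 0) := by
  rw [exampleField_apply]
  have h : (coeffDeriv P).eval 0 = derivative (P.eval 0) := by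
    rw [← coeff_zero_eq_eval_zero, coeff_coeffDeriv, coeff_zero_eq_eval_zero]
  simp [h]

theorem order_eq_of_exampleField {a b : ℕ} {P Q : ℂ[X][X]} (hP : P.eval 0 ≠ 0)
    (hQ : Q.eval 0 ≠ 0)
    (h : X ^ b * Q * exampleField (X ^ a * P) = X ^ a * P * exampleField (X ^ b * Q)) :
    a = b ∧ (P.eval 0).natDegree = (Q.eval 0).natDegree := by
  rw [exampleField_X_pow_mul, exampleField_X_pow_mul] at h
  have h1 : Q * (exampleField P + (a : ℂ[X][X]) * ((C X + X + 5 * C X ^ 3) * P))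
      = P * (exampleField Q + (b : ℂ[X][X]) * ((C X + X + 5 * C X ^ 3) * Q)) := by
    apply mul_left_cancel₀ (pow_ne_zero (a + b) (X_ne_zero (R := ℂ[X])))
    rw [pow_add]
    linear_combination h
  have h2 := congrArg (eval 0) h1
  simp only [eval_mul, eval_add, eval_zero_exampleField, eval_natCast, eval_C, eval_X, eval_pow,
    eval_ofNat, add_zero] at h2
  exact natDegree_eq_of_wronskian hP hQ h2

theorem exists_eq_X_pow_mul_eval_zero_ne_zero {R : Type*} [CommRing R] {P : R[X]} (hP : P ≠ 0) :
    ∃ (a : ℕ) (P' : R[X]), P = X ^ a * P' ∧ P'.eval 0 ≠ 0 := by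
  obtain ⟨P', h, h'⟩ := exists_eq_pow_rootMultiplicity_mul_and_not_dvd P hP 0
  rw [C_0, sub_zero] at h h'
  exact ⟨_, P', h, by rwa [X_dvd_iff, coeff_zero_eq_eval_zero] at h'⟩

theorem eq_const_mul_of_exampleField {P Q : ℂ[X][X]} (hQ : Q ≠ 0)
    (h : Q * exampleField P = P * exampleField Q) : ∃ c : ℂ, P = C (C c) * Q := by
  by_cases hP : P = 0
  · exact ⟨0, by simp [hP]⟩
  obtain ⟨a, P, rfl, hP0⟩ := exists_eq_X_pow_mul_eval_zero_ne_zero hP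
  obtain ⟨b, Q, rfl, hQ0⟩ := exists_eq_X_pow_mul_eval_zero_ne_zero hQ
  obtain ⟨rfl, hdeg⟩ := order_eq_of_exampleField hP0 hQ0 h
  have hlq : (Q.eval 0).leadingCoeff ≠ 0 := leadingCoeff_ne_zero.mpr hQ0
  set c := (P.eval 0).leadingCoeff / (Q.eval 0).leadingCoeff with hc
  refine ⟨c, sub_eq_zero.mp ?_⟩
  by_contra hne
  obtain ⟨d, R, hR, hR0⟩ := exists_eq_X_pow_mul_eval_zero_ne_zero hne
  have hDc : exampleField (C (C c) * (X ^ a * Q)) = C (C c) * exampleField (X ^ a * Q) := by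
    have (S : ℂ[X][X]) : C (C c) * S = c • S := by
      rw [← smul_eq_C_mul, ← algebraMap_eq, algebraMap_smul]
    rw [this, this, Derivation.map_smul]
  obtain ⟨rfl, hdeg'⟩ := order_eq_of_exampleField (a := d) hR0 hQ0 (by
    rw [← hR, map_sub, hDc]
    linear_combination h)
  have hR' : R = P - C (C c) * Q := by
    apply mul_left_cancel₀ (pow_ne_zero d (X_ne_zero (R := ℂ[X])))
    rw [← hR]
    ring
  apply leadingCoeff_ne_zero.mpr hR0
  rw [leadingCoeff, hdeg', hR', eval_sub, eval_mul, eval_C, coeff_sub, coeff_C_mul,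
    coeff_natDegree, ← hdeg, coeff_natDegree, hc, div_mul_cancel₀ _ hlq, sub_self]

end Polynomial

/-- **Example 4.4.** The planar vector field
`X = (x² + xy − y³)·∂/∂x + (xy + y² + 5x³y)·∂/∂y` is not algebraically
integrable: it admits no nonconstant rational first integral. -/
theorem example_4_4_not_algebraically_integrable :
    ¬ ∃ f : RF2, ¬ IsConstRF f ∧
      ∃ p q : P2, q ≠ 0 ∧ f = rf p q ∧
        FirstIntegralRep (X 0 ^ 2 + X 0 * X 1 - X 1 ^ 3)
          (X 0 * X 1 + X 1 ^ 2 + 5 * X 0 ^ 3 * X 1) p q := by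
  rintro ⟨f, hf, p, q, hq, rfl, h⟩
  let e := Polynomial.Bivariate.equivMvPolynomial ℂ
  obtain ⟨P, rfl⟩ := e.surjective p
  obtain ⟨Q, rfl⟩ := e.surjective q
  have hQ : Q ≠ 0 := (map_ne_zero_iff _ e.injective).mp hq
  have hx (R) : e.symm (pderiv 0 (e R)) = Polynomial.coeffDeriv R := by
    rw [Polynomial.Bivariate.pderiv_zero_equivMvPolynomial, AlgEquiv.symm_apply_apply]
    rfl
  have hy (R) : e.symm (pderiv 1 (e R)) = Polynomial.derivative R := by
    rw [Polynomial.Bivariate.pderiv_one_equivMvPolynomial, AlgEquiv.symm_apply_apply]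
  have h1 := congrArg e.symm h
  simp only [map_add, map_sub, map_mul, map_pow, map_ofNat, map_zero,
    AlgEquiv.symm_apply_apply, hx, hy] at h1
  simp only [e, Polynomial.Bivariate.equivMvPolynomial_symm_X_0,
    Polynomial.Bivariate.equivMvPolynomial_symm_X_1] at h1
  obtain ⟨c, rfl⟩ := Polynomial.eq_const_mul_of_exampleField (P := P) hQ (by
    rw [Polynomial.exampleField_apply, Polynomial.exampleField_apply]
    linear_combination h1)
  refine hf ⟨c, ?_⟩
  have hq' : algebraMap P2 RF2 (e Q) ≠ 0 :=
    (map_ne_zero_iff _ (IsFractionRing.injective P2 RF2)).mpr hq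
  rw [rf, map_mul e, map_mul, mul_div_cancel_right₀ _ hq',
    Polynomial.Bivariate.equivMvPolynomial_C_C]


end
end

section
/- The planar polynomial vector field defined by the differential 1-form ω = (y + xy)dx + (1 + xy² + x²)dy, namely X = −(1 + x² + xy²)·∂/∂x + y(1 + x)·∂/∂y, is not algebraically integrable: there is no nonconstant rational function f ∈ ℂ(x,y) such that (1 + x² + xy²)·∂f/∂x = y(1 + x)·∂f/∂y. -/
open MvPolynomial

noncomputable section

/-- All coefficients of `p` at exponents lexicographically below `d` vanish. -/
def VanishesBelow (p : P2) (d : Fin 2 →₀ ℕ) : Prop :=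
  ∀ x, toLex x < toLex d → coeff x p = 0

lemma exists_vanishesBelow {p : P2} (hp : p ≠ 0) :
    ∃ d, VanishesBelow p d ∧ coeff d p ≠ 0 := by
  obtain ⟨d, hd, hmin⟩ := p.support.exists_min_image (fun x => toLex x) (support_nonempty.2 hp)
  refine ⟨d, fun x hx => ?_, mem_support_iff.1 hd⟩
  by_contra h
  exact absurd (hmin x (mem_support_iff.2 h)) (not_le.2 hx)

lemma VanishesBelow.coeff_mul {p q : P2} {d e : Fin 2 →₀ ℕ}
    (hp : VanishesBelow p d) (hq : VanishesBelow q e) :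
    coeff (d + e) (p * q) = coeff d p * coeff e q := by
  classical
  rw [MvPolynomial.coeff_mul]
  refine Finset.sum_eq_single (d, e) ?_ (fun h => absurd (by simp) h)
  rintro ⟨x, y⟩ hxy hne
  have hsum : x + y = d + e := Finset.HasAntidiagonal.mem_antidiagonal.1 hxy
  rcases lt_trichotomy (toLex x) (toLex d) with h | h | h
  · simp [hp x h]
  · obtain rfl : x = d := h
    exact absurd (by rw [add_left_cancel hsum]) hne
  · have hy : toLex y < toLex e := by
      by_contra hy
      have hlt : toLex d + toLex e < toLex x + toLex y := add_lt_add_of_lt_of_le h (not_lt.1 hy)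
      rw [← toLex_add, ← toLex_add, hsum] at hlt
      exact lt_irrefl _ hlt
    simp [hq y hy]

lemma toLex_lt_add_single (e : Fin 2 →₀ ℕ) (s : Fin 2) :
    toLex e < toLex (e + Finsupp.single s 1) := by
  rw [toLex_add]
  refine lt_add_of_pos_right _ ?_
  refine lt_of_le_of_ne (Finsupp.toLex_monotone (zero_le : 0 ≤ Finsupp.single s 1)) fun h => ?_
  simpa using congrArg (fun x : Lex (Fin 2 →₀ ℕ) => ofLex x s) h

lemma coeff_X_mul_eq_zero {g : P2} {e : Fin 2 →₀ ℕ} (s : Fin 2)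
    (h : ∀ e', e = e' + Finsupp.single s 1 → coeff e' g = 0) : coeff e (X s * g) = 0 := by
  classical
  rw [coeff_X_mul']
  split_ifs with hs
  · refine h _ (tsub_add_cancel_of_le ?_).symm
    rw [Finsupp.single_le_iff]
    exact Nat.one_le_iff_ne_zero.2 (Finsupp.mem_support_iff.1 hs)
  · rfl

lemma VanishesBelow.coeff_X_mul {g : P2} {e : Fin 2 →₀ ℕ} (hg : VanishesBelow g e) (s : Fin 2) :
    coeff e (X s * g) = 0 :=
  coeff_X_mul_eq_zero s fun e' he' => hg e' (he' ▸ toLex_lt_add_single e' s)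

lemma VanishesBelow.mono {g : P2} {d e : Fin 2 →₀ ℕ} (hg : VanishesBelow g e)
    (h : toLex d ≤ toLex e) : VanishesBelow g d :=
  fun x hx => hg x (hx.trans_le h)

lemma VanishesBelow.X_mul {g : P2} {e : Fin 2 →₀ ℕ} (hg : VanishesBelow g e) (s : Fin 2) :
    VanishesBelow (X s * g) e :=
  fun _ hx => (hg.mono hx.le).coeff_X_mul s

lemma coeff_X_mul_pderiv (s : Fin 2) (p : P2) (e : Fin 2 →₀ ℕ) :
    coeff e (X s * pderiv s p) = e s * coeff e p := by
  induction p using MvPolynomial.induction_on' with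
  | add p q hp hq => simp only [map_add, mul_add, coeff_add, hp, hq]
  | monomial n a =>
    rw [X_mul_pderiv_monomial, coeff_smul, coeff_monomial]
    split_ifs with h
    · subst h; simp
    · simp

lemma VanishesBelow.X_mul_pderiv {p : P2} {e : Fin 2 →₀ ℕ} (hp : VanishesBelow p e) (s : Fin 2) :
    VanishesBelow (X s * pderiv s p) e := fun x hx => by
  rw [coeff_X_mul_pderiv, hp x hx, mul_zero]

/-- The vector field in the coordinates `(y, x - i)`, centred at its singular point `(i, 0)`. -/
def shiftedField (p : P2) : P2 :=
  -(1 + (X 1 + C Complex.I) ^ 2 + (X 1 + C Complex.I) * X 0 ^ 2) * pderiv 1 p +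
    X 0 * (1 + (X 1 + C Complex.I)) * pderiv 0 p

/-- The eigenvalue of the linear part of `shiftedField` on the monomial of exponent `e`. -/
def eigenvalue (e : Fin 2 →₀ ℕ) : ℂ := -(2 * Complex.I) * e 1 + (1 + Complex.I) * e 0

lemma eigenvalue_injective : Function.Injective eigenvalue := by
  intro d e h
  have hre := congrArg Complex.re h
  have him := congrArg Complex.im h
  simp [eigenvalue] at hre him
  have h0 : d 0 = e 0 := hre
  have h1 : d 1 = e 1 := by
    rw [h0] at him
    have : (d 1 : ℝ) = e 1 := by linarith
    exact_mod_cast this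
  ext s
  fin_cases s
  · exact h0
  · exact h1

lemma shiftedField_eq (p : P2) :
    shiftedField p = C (-(2 * Complex.I)) * (X 1 * pderiv 1 p)
      + C (1 + Complex.I) * (X 0 * pderiv 0 p)
      - X 1 * (X 1 * pderiv 1 p) - X 0 * (X 0 * (X 1 * pderiv 1 p))
      - C Complex.I * (X 0 * (X 0 * pderiv 1 p)) + X 1 * (X 0 * pderiv 0 p) := by
  have hI : (C Complex.I : P2) ^ 2 = -1 := by rw [← C_pow, Complex.I_sq, C_neg, C_1]
  have h2 : (C (2 : ℂ) : P2) = 2 := map_ofNat C 2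
  simp only [shiftedField, C_neg, C_mul, C_add, C_1, h2]
  linear_combination -(pderiv 1 p) * hI

lemma VanishesBelow.coeff_shiftedField {p : P2} {e : Fin 2 →₀ ℕ} (hp : VanishesBelow p e) :
    coeff e (shiftedField p) = eigenvalue e * coeff e p := by
  have hlow : coeff e (X 0 * (X 0 * pderiv 1 p)) = 0 := by
    refine coeff_X_mul_eq_zero 0 fun e' he' => coeff_X_mul_eq_zero 0 fun e'' he'' => ?_
    rw [coeff_pderiv, hp, zero_mul]
    refine Finsupp.Lex.lt_iff.2 ⟨0, fun j hj => absurd hj (Fin.not_lt_zero j), ?_⟩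
    simp [he', he'']
  have h1 := hp.X_mul_pderiv 1
  have h0 := hp.X_mul_pderiv 0
  rw [shiftedField_eq]
  simp only [coeff_add, coeff_sub, coeff_C_mul, hlow, h1.coeff_X_mul, h0.coeff_X_mul,
    (h1.X_mul 0).coeff_X_mul, coeff_X_mul_pderiv, eigenvalue]
  ring

lemma VanishesBelow.shiftedField {p : P2} {e : Fin 2 →₀ ℕ} (hp : VanishesBelow p e) :
    VanishesBelow (shiftedField p) e := fun x hx => by
  rw [(hp.mono hx.le).coeff_shiftedField, hp x hx, mul_zero]

lemma eq_of_shiftedField_mul_eq {p q : P2} {d e : Fin 2 →₀ ℕ}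
    (h : shiftedField p * q = p * shiftedField q)
    (hp : VanishesBelow p d) (hpd : coeff d p ≠ 0)
    (hq : VanishesBelow q e) (hqe : coeff e q ≠ 0) : d = e := by
  have hc := congrArg (coeff (d + e)) h
  rw [hp.shiftedField.coeff_mul hq, hp.coeff_mul hq.shiftedField, hp.coeff_shiftedField,
    hq.coeff_shiftedField] at hc
  apply eigenvalue_injective
  apply mul_right_cancel₀ (mul_ne_zero hpd hqe)
  linear_combination hc

lemma exists_eq_C_mul_of_shiftedField {p q : P2} (hq : q ≠ 0)
    (h : shiftedField p * q = p * shiftedField q) : ∃ c : ℂ, p = C c * q := by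
  obtain ⟨e, hqe, hqe0⟩ := exists_vanishesBelow hq
  refine ⟨coeff e p / coeff e q, ?_⟩
  set c := coeff e p / coeff e q with hc
  by_contra hne
  obtain ⟨d, hd, hd0⟩ := exists_vanishesBelow (sub_ne_zero.2 hne)
  have hlin : shiftedField (p - C c * q) = shiftedField p - C c * shiftedField q := by
    simp only [shiftedField, map_sub, pderiv_C_mul]
    ring
  have hde : d = e := by
    refine eq_of_shiftedField_mul_eq ?_ hd hd0 hqe hqe0
    rw [hlin]
    linear_combination h
  subst hde
  apply hd0
  rw [coeff_sub, coeff_C_mul, hc, div_mul_cancel₀ _ hqe0, sub_self]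

/-- The change of coordinates `x ↦ X 1 + i`, `y ↦ X 0`. -/
def shift : P2 →ₐ[ℂ] P2 := aeval ![X 1 + C Complex.I, X 0]

lemma shift_injective : Function.Injective shift := by
  have h : (aeval ![X 1, X 0 - C Complex.I] : P2 →ₐ[ℂ] P2).comp shift = AlgHom.id ℂ P2 := by
    ext s
    fin_cases s <;> simp [shift, algHom_C]
  refine Function.LeftInverse.injective (g := (aeval ![X 1, X 0 - C Complex.I] : P2 →ₐ[ℂ] P2)) ?_
  exact fun p => DFunLike.congr_fun h p

lemma shift_pderiv (p : P2) :
    shift (pderiv 0 p) = pderiv 1 (shift p) ∧ shift (pderiv 1 p) = pderiv 0 (shift p) := by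
  induction p using MvPolynomial.induction_on with
  | C a => simp [shift, algHom_C]
  | add p q hp hq => simp [hp, hq]
  | mul_X p s hp =>
    fin_cases s <;> simp [hp] <;> simp [shift, pderiv_X]

/-- **Example 4.7.** The planar vector field defined by the 1-form
`ω = (y + xy)dx + (1 + xy² + x²)dy`, namely
`X = −(1 + x² + xy²)·∂/∂x + y(1 + x)·∂/∂y`, is not algebraically integrable:
it admits no nonconstant rational first integral. -/
theorem example_4_7_not_algebraically_integrable :
    ¬ ∃ f : RF2, ¬ IsConstRF f ∧
      ∃ p q : P2, q ≠ 0 ∧ f = rf p q ∧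
        FirstIntegralRep (-(1 + X 0 ^ 2 + X 0 * X 1 ^ 2)) (X 1 * (1 + X 0)) p q := by
  rintro ⟨f, hf, p, q, hq, rfl, h⟩
  have hs : shift q ≠ 0 := fun h0 => hq (shift_injective (h0.trans (map_zero shift).symm))
  have hX0 : shift (X 0) = X 1 + C Complex.I := by simp [shift]
  have hX1 : shift (X 1) = X 0 := by simp [shift]
  obtain ⟨c, hc⟩ : ∃ c : ℂ, shift p = C c * shift q := by
    refine exists_eq_C_mul_of_shiftedField hs ?_
    have h' := congrArg shift h
    simp only [map_add, map_mul, map_neg, map_sub, map_pow, map_one, map_zero, hX0, hX1,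
      (shift_pderiv _).1, (shift_pderiv _).2] at h'
    simp only [shiftedField]
    linear_combination h'
  have hpq : p = C c * q := by
    apply shift_injective
    rw [hc, map_mul, shift, algHom_C]
    rfl
  refine hf ⟨c, ?_⟩
  have hq' : algebraMap P2 RF2 q ≠ 0 := by
    rwa [Ne, IsFractionRing.to_map_eq_zero_iff]
  rw [rf, hpq, map_mul, mul_div_cancel_right₀ _ hq']

end
end
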